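/- arXiv:2406.12697 — 2 statements merged into one kernel-verified Lean document; each statement's English description precedes it below -/
import Mathlib

section
/- Let X be a compact metrizable space and N a closed subset of the space of Borel probability measures on X consisting of atomless measures, and suppose X has the N-SBP. Let A₀ and A₁ be disjoint closed subsets of X. Then there is a continuous function f : X → [0,1] such that f = 0 on A₀, f = 1 on A₁, and for every t ∈ [0,1] the set f⁻¹(t) \ (A₀ ∪ A₁) is N-small (i.e., μ(f⁻¹(t) \ (A₀ ∪ A₁)) = 0 for all μ ∈ N). -/
open MeasureTheory Topology

def NSmall {X : Type*} [TopologicalSpace X] [MeasurableSpace X]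
    (N : Set (ProbabilityMeasure X)) (A : Set X) : Prop :=
  ∀ μ ∈ N, (μ : Measure X) A = 0

def NSBP {X : Type*} [TopologicalSpace X] [MeasurableSpace X]
    (N : Set (ProbabilityMeasure X)) : Prop :=
  ∃ B : Set (Set X), TopologicalSpace.IsTopologicalBasis B ∧ ∀ U ∈ B, NSmall N (frontier U)

section Helpers

open Set Filter
open scoped ENNReal

section Measures

variable {X : Type*} [TopologicalSpace X] [TopologicalSpace.MetrizableSpace X]
  [MeasurableSpace X] [BorelSpace X]

lemma eventually_measure_lt_of_isClosed (μ : ProbabilityMeasure X) {F : Set X} (hF : IsClosed F)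
    {ε : ℝ≥0∞} (h : (μ : Measure X) F < ε) :
    ∀ᶠ ν : ProbabilityMeasure X in 𝓝 μ, (ν : Measure X) F < ε :=
  eventually_lt_of_limsup_lt
    ((ProbabilityMeasure.limsup_measure_closed_le_of_tendsto tendsto_id hF).trans_lt h)

variable [CompactSpace X]

/-- A closed set that is uniformly small for a compact family of measures has an open
neighbourhood that is uniformly small. -/
lemma exists_isOpen_superset_forall_measure_lt {N : Set (ProbabilityMeasure X)}
    (hN : IsClosed N) {F : Set X} (hF : IsClosed F) {ε : ℝ≥0∞}
    (h : ∀ μ ∈ N, (μ : Measure X) F < ε) :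
    ∃ O, IsOpen O ∧ F ⊆ O ∧ ∀ μ ∈ N, (μ : Measure X) O < ε := by
  let _ := TopologicalSpace.metrizableSpaceMetric X
  refine hN.isCompact.induction_on
    (p := fun S ↦ ∃ O, IsOpen O ∧ F ⊆ O ∧ ∀ μ ∈ S, (μ : Measure X) O < ε) ?_ ?_ ?_ ?_
  · exact ⟨univ, isOpen_univ, subset_univ _, by simp⟩
  · rintro S T hST ⟨O, hO, hFO, hT⟩
    exact ⟨O, hO, hFO, fun μ hμ ↦ hT μ (hST hμ)⟩
  · rintro S T ⟨O, hO, hFO, hS⟩ ⟨O', hO', hFO', hT⟩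
    refine ⟨O ∩ O', hO.inter hO', subset_inter hFO hFO', ?_⟩
    rintro μ (hμ | hμ)
    · exact (measure_mono inter_subset_left).trans_lt (hS μ hμ)
    · exact (measure_mono inter_subset_right).trans_lt (hT μ hμ)
  · intro μ hμ
    obtain ⟨U, hFU, hU, hμU⟩ := F.exists_isOpen_lt_of_lt (μ := (μ : Measure X)) ε (h μ hμ)
    obtain ⟨V, hV, hFV, hVU⟩ := normal_exists_closure_subset hF hU hFU
    refine ⟨{ν : ProbabilityMeasure X | (ν : Measure X) (closure V) < ε}, mem_nhdsWithin_of_mem_nhds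
      (eventually_measure_lt_of_isClosed μ isClosed_closure ((measure_mono hVU).trans_lt hμU)),
      V, hV, hFV, fun ν hν ↦ (measure_mono subset_closure).trans_lt hν⟩

lemma isOpen_setOf_forall_measure_fiber_inter_lt {N : Set (ProbabilityMeasure X)}
    (hN : IsClosed N) {K : Set X} (hK : IsClosed K) (ε : ℝ≥0∞) :
    IsOpen {f : C(X, ℝ) | ∀ t ∈ Icc (0 : ℝ) 1, ∀ μ ∈ N, (μ : Measure X) (f ⁻¹' {t} ∩ K) < ε} := by
  rw [isOpen_iff_eventually]
  intro f hf
  refine isCompact_Icc.eventually_forall_of_forall_eventually fun t ht ↦ ?_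
  obtain ⟨O, hO, hFO, hμO⟩ := exists_isOpen_superset_forall_measure_lt hN
    ((isClosed_singleton.preimage f.continuous).inter hK) (hf t ht)
  have hev : ∀ᶠ z : C(X, ℝ) × ℝ in 𝓝 (f, t), ∀ x ∈ K \ O, z.1 x ≠ z.2 := by
    refine (hK.sdiff hO).isCompact.eventually_forall_of_forall_eventually fun x hx ↦ ?_
    have hopen : IsOpen {w : (C(X, ℝ) × ℝ) × X | w.1.1 w.2 ≠ w.1.2} :=
      isOpen_ne_fun (by fun_prop) (by fun_prop)
    exact hopen.mem_nhds fun hfx ↦ hx.2 (hFO ⟨hfx, hx.1⟩)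
  filter_upwards [hev] with z hz μ hμ
  refine (measure_mono ?_).trans_lt (hμO μ hμ)
  rintro x ⟨hx, hxK⟩
  by_contra hxO
  exact hz x ⟨hxK, hxO⟩ hx

/-- For a closed family of atomless measures, every point has uniformly small neighbourhoods in
any basis on which a given continuous function oscillates little. -/
lemma exists_basis_mem_small {N : Set (ProbabilityMeasure X)} (hN : IsClosed N)
    (hatomless : ∀ μ ∈ N, ∀ x : X, (μ : Measure X) {x} = 0) {B : Set (Set X)}
    (hB : TopologicalSpace.IsTopologicalBasis B) {ε : ℝ≥0∞} (hε : 0 < ε) (f : C(X, ℝ))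
    {η : ℝ} (hη : 0 < η) (x : X) :
    ∃ U ∈ B, x ∈ U ∧ (∀ μ ∈ N, (μ : Measure X) U < ε) ∧ ∀ y ∈ U, |f y - f x| < η := by
  obtain ⟨O, hO, hxO, hμO⟩ := exists_isOpen_superset_forall_measure_lt hN
    (isClosed_singleton (x := x)) (ε := ε) fun μ hμ ↦ by rwa [hatomless μ hμ x]
  have hV : IsOpen {y | |f y - f x| < η} := isOpen_lt (by fun_prop) (by fun_prop)
  obtain ⟨U, hUB, hxU, hU⟩ := hB.exists_subset_of_mem_open
    (show x ∈ O ∩ {y | |f y - f x| < η} from ⟨hxO rfl, by simpa⟩) (hO.inter hV)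
  exact ⟨U, hUB, hxU, fun μ hμ ↦ (measure_mono fun y hy ↦ (hU hy).1).trans_lt (hμO μ hμ),
    fun y hy ↦ (hU hy).2⟩

end Measures

/-- A finite family of points of the unit interval can be perturbed to an injective one. -/
lemma exists_injOn_Icc_dist_lt {ι : Type*} (s : Finset ι) (a : ι → ℝ)
    (ha : ∀ i, a i ∈ Icc (0 : ℝ) 1) {η : ℝ} (hη : 0 < η) :
    ∃ c : ι → ℝ, InjOn c s ∧ ∀ i, c i ∈ Icc (0 : ℝ) 1 ∧ |c i - a i| < η := by
  classical
  induction s using Finset.induction_on with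
  | empty => exact ⟨a, by simp, fun i ↦ ⟨ha i, by simpa⟩⟩
  | insert j s hj ih =>
    obtain ⟨c, hc, hca⟩ := ih
    obtain ⟨r, hr, hrs⟩ : ∃ r ∈ Icc (0 : ℝ) 1 ∩ Ioo (a j - η) (a j + η), r ∉ s.image c := by
      have hinf : (Icc (0 : ℝ) 1 ∩ Ioo (a j - η) (a j + η)).Infinite := by
        refine (Ioo_infinite (a := max 0 (a j - η)) (b := min 1 (a j + η)) ?_).mono ?_
        · obtain ⟨h0, h1⟩ := ha j
          simp only [max_lt_iff, lt_min_iff]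
          constructor <;> constructor <;> linarith
        · rintro r ⟨h1, h2⟩
          simp only [max_lt_iff, lt_min_iff] at h1 h2
          exact ⟨⟨h1.1.le, h2.1.le⟩, h1.2, h2.2⟩
      exact hinf.exists_notMem_finset _
    refine ⟨Function.update c j r, ?_, fun i ↦ ?_⟩
    · have heq : EqOn c (Function.update c j r) s := fun i hi ↦
        (Function.update_of_ne (fun h : i = j ↦ hj (h ▸ hi)) r c).symm
      rw [Finset.coe_insert, injOn_insert (by simpa using hj)]
      refine ⟨hc.congr heq, ?_⟩
      rw [← heq.image_eq, Function.update_self]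
      simpa using hrs
    · rcases eq_or_ne i j with rfl | hi
      · rw [Function.update_self]
        exact ⟨hr.1, abs_lt.2 ⟨by linarith [hr.2.1], by linarith [hr.2.2]⟩⟩
      · rw [Function.update_of_ne hi]
        exact hca i

/-- For a finite open cover, the choice of a member containing a given point can be made locally
constant away from the boundaries of the cover. -/
lemma exists_mem_cover_eventuallyEq {X ι : Type*} [TopologicalSpace X] [Finite ι] (U : ι → Set X)
    (hU : ⋃ i, U i = univ) :
    ∃ p : X → ι, (∀ x, x ∈ U (p x)) ∧
      ∀ x, x ∉ ⋃ i, frontier (U i) → ∀ᶠ y in 𝓝 x, p y = p x := by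
  classical
  have hne : ∀ x, ∃ i, x ∈ U i := fun x ↦ mem_iUnion.1 (hU ▸ mem_univ x)
  let q : {S : Set ι // S.Nonempty} → ι := fun S ↦ S.2.some
  refine ⟨fun x ↦ q ⟨{i | x ∈ U i}, hne x⟩, fun x ↦ Set.Nonempty.some_mem (s := {i | x ∈ U i}) (hne x),
    fun x hx ↦ ?_⟩
  have hloc : ∀ i, ∀ᶠ y in 𝓝 x, (y ∈ U i ↔ x ∈ U i) := by
    intro i
    have hi : x ∉ frontier (U i) := fun h ↦ hx (mem_iUnion.2 ⟨i, h⟩)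
    by_cases hxi : x ∈ U i
    · have : x ∈ interior (U i) := by
        by_contra h
        exact hi ⟨subset_closure hxi, h⟩
      filter_upwards [mem_interior_iff_mem_nhds.1 this] with y hy
      simp [hxi, hy]
    · have : x ∈ interior (U i)ᶜ := by
        by_contra h
        rw [← frontier_compl] at hi
        exact hi ⟨subset_closure hxi, h⟩
      filter_upwards [mem_interior_iff_mem_nhds.1 this] with y hy
      simp only [hxi, iff_false]
      exact hy
  filter_upwards [eventually_all.2 hloc] with y hy
  exact congrArg q (Subtype.ext (Set.ext hy))

/-- Interpolating between a continuous function `f` and a function `s` that is locally constant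
off `D`, by means of a cutoff function vanishing on `D`, gives a continuous function. -/
lemma continuous_add_mul_sub_of_eventuallyEq {X : Type*} [TopologicalSpace X] {f φ s : X → ℝ}
    (hf : Continuous f) (hφ : Continuous φ) {D : Set X} (hD : ∀ x ∈ D, φ x = 0)
    (hs : ∀ x, x ∉ D → ∀ᶠ y in 𝓝 x, s y = s x) {C : ℝ} (hC : ∀ x, |s x - f x| ≤ C) :
    Continuous fun x ↦ f x + φ x * (s x - f x) := by
  refine hf.add (continuous_iff_continuousAt.2 fun x ↦ ?_)
  by_cases hx : x ∈ D
  · have h : Tendsto (fun y ↦ φ y * (s y - f y)) (𝓝 x) (𝓝 0) :=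
      (hD x hx ▸ hφ.tendsto x : Tendsto φ (𝓝 x) (𝓝 0)).zero_mul_isBoundedUnder_le
        (isBoundedUnder_of ⟨C, hC⟩)
    simpa [ContinuousAt, hD x hx] using h
  · have hsx : ContinuousAt s x := continuousAt_const.congr ((hs x hx).mono fun y hy ↦ hy.symm)
    exact hφ.continuousAt.mul (hsx.sub hf.continuousAt)

section Perturbation

variable {X : Type*} [TopologicalSpace X] [CompactSpace X] [TopologicalSpace.MetrizableSpace X]
  [MeasurableSpace X] [BorelSpace X]

/-- Under the small boundary property, a function with values in the unit interval can be
perturbed, relative to a closed set `A`, so that its fibers are uniformly small on a closed set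
disjoint from `A`. -/
lemma exists_perturbation_measure_fiber_inter_lt {N : Set (ProbabilityMeasure X)}
    (hN : IsClosed N) (hatomless : ∀ μ ∈ N, ∀ x : X, (μ : Measure X) {x} = 0) (hSBP : NSBP N)
    {A K : Set X} (hA : IsClosed A) (hK : IsClosed K) (hAK : Disjoint A K)
    {ε : ℝ≥0∞} (hε : 0 < ε) {η : ℝ} (hη : 0 < η) (f : C(X, ℝ)) (hf : ∀ x, f x ∈ Icc (0 : ℝ) 1) :
    ∃ g : C(X, ℝ), (∀ x, g x ∈ Icc (0 : ℝ) 1) ∧ EqOn g f A ∧ (∀ x, |g x - f x| ≤ η) ∧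
      ∀ t, ∀ μ ∈ N, (μ : Measure X) (g ⁻¹' {t} ∩ K) < ε := by
  obtain ⟨B, hB, hBN⟩ := hSBP
  choose U hUB hxU hUμ hUf using
    exists_basis_mem_small hN hatomless hB (ENNReal.half_pos hε.ne') f (half_pos hη)
  obtain ⟨T, hT⟩ := isCompact_univ.elim_finite_subcover U (fun x ↦ hB.isOpen (hUB x))
    fun x _ ↦ mem_iUnion.2 ⟨x, hxU x⟩
  obtain ⟨c, hcinj, hc⟩ := exists_injOn_Icc_dist_lt T f hf (half_pos hη)
  obtain ⟨p, hpU, hp⟩ := exists_mem_cover_eventuallyEq (fun i : T ↦ U i) <| by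
    rw [← univ_subset_iff]
    simpa [iUnion_subtype] using hT
  set D : Set X := ⋃ i : T, frontier (U i) with hD_def
  have hDc : IsClosed D := isClosed_iUnion_of_finite fun _ ↦ isClosed_frontier
  have hDμ : ∀ μ ∈ N, (μ : Measure X) D < ε / 2 := fun μ hμ ↦ by
    rw [hD_def, measure_iUnion_null fun i : T ↦ hBN _ (hUB i) μ hμ]
    exact ENNReal.half_pos hε.ne'
  obtain ⟨O, hO, hDO, hOμ⟩ := exists_isOpen_superset_forall_measure_lt hN hDc hDμ
  obtain ⟨φ, hφ0, hφ1, hφ⟩ := exists_continuous_zero_one_of_isClosed (hA.union hDc) (hK.sdiff hO)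
    (disjoint_union_left.2 ⟨hAK.mono_right sdiff_subset, disjoint_sdiff_right.mono_left hDO⟩)
  have hsf : ∀ x, |c (p x) - f x| ≤ η := fun x ↦ by
    have h1 := (hc (p x)).2
    have h2 := hUf _ x (hpU x)
    rw [abs_lt] at h1 h2
    rw [abs_le]
    constructor <;> linarith [h1.1, h1.2, h2.1, h2.2]
  refine ⟨⟨_, continuous_add_mul_sub_of_eventuallyEq (s := fun x ↦ c (p x)) f.continuous
    φ.continuous (fun x hx ↦ hφ0 (Or.inr hx))
    (fun x hx ↦ (hp x hx).mono fun y hy ↦ by rw [hy]) hsf⟩, fun x ↦ ?_, fun x hx ↦ ?_,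
    fun x ↦ ?_, fun t μ hμ ↦ ?_⟩
  · obtain ⟨h0, h1⟩ := hφ x
    obtain ⟨f0, f1⟩ := hf x
    obtain ⟨c0, c1⟩ := (hc (p x)).1
    constructor
    · change 0 ≤ f x + φ x * (c (p x) - f x)
      nlinarith
    · change f x + φ x * (c (p x) - f x) ≤ 1
      nlinarith
  · have : φ x = 0 := hφ0 (Or.inl hx)
    simp [this]
  · have h0 := hφ x
    simp only [ContinuousMap.coe_mk, add_sub_cancel_left, abs_mul, abs_of_nonneg h0.1]
    nlinarith [h0.1, h0.2, hsf x, abs_nonneg (c (p x) - f x)]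
  · set g : C(X, ℝ) := ⟨_, _⟩
    have hg : ∀ x ∈ K \ O, g x = c (p x) := fun x hx ↦ by
      change f x + φ x * (c (p x) - f x) = c (p x)
      rw [hφ1 hx]
      simp
    obtain ⟨V, hV, hVt⟩ : ∃ V : Set X, (μ : Measure X) V ≤ ε / 2 ∧
        g ⁻¹' {t} ∩ (K \ O) ⊆ V := by
      rcases (g ⁻¹' {t} ∩ (K \ O)).eq_empty_or_nonempty with h | ⟨x, hxt, hx⟩
      · exact ⟨∅, by simp, h.subset⟩
      · refine ⟨U (p x), (hUμ _ μ hμ).le, fun y ⟨hyt, hy⟩ ↦ ?_⟩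
        have hcxy : c (p y) = c (p x) := by
          rw [← hg x hx, ← hg y hy]
          exact hyt.trans hxt.symm
        rw [← hcinj (p y).2 (p x).2 hcxy]
        exact hpU y
    calc (μ : Measure X) (g ⁻¹' {t} ∩ K) ≤ (μ : Measure X) (V ∪ O) := measure_mono fun x hx ↦ by
          by_cases hxO : x ∈ O
          · exact Or.inr hxO
          · exact Or.inl (hVt ⟨hx.1, hx.2, hxO⟩)
      _ ≤ (μ : Measure X) V + (μ : Measure X) O := measure_union_le _ _
      _ < ε / 2 + ε / 2 :=
        ENNReal.add_lt_add_of_le_of_lt (measure_ne_top _ _) hV (hOμ μ hμ)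
      _ = ε := ENNReal.add_halves ε

end Perturbation

end Helpers

/-- The small boundary Urysohn lemma. -/
theorem small_boundary_urysohn {X : Type*} [TopologicalSpace X] [CompactSpace X]
    [TopologicalSpace.MetrizableSpace X] [MeasurableSpace X] [BorelSpace X]
    (N : Set (ProbabilityMeasure X)) (hN : IsClosed N)
    (hatomless : ∀ μ ∈ N, ∀ x : X, (μ : Measure X) {x} = 0) (hSBP : NSBP N)
    (A₀ A₁ : Set X) (hA₀ : IsClosed A₀) (hA₁ : IsClosed A₁) (hdisj : Disjoint A₀ A₁) :
    ∃ f : X → ℝ, Continuous f ∧ (∀ x, f x ∈ Set.Icc (0 : ℝ) 1) ∧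
      (∀ x ∈ A₀, f x = 0) ∧ (∀ x ∈ A₁, f x = 1) ∧
      ∀ t ∈ Set.Icc (0 : ℝ) 1, NSmall N (f ⁻¹' {t} \ (A₀ ∪ A₁)) := by
  let _ := TopologicalSpace.metrizableSpaceMetric X
  have hA : IsClosed (A₀ ∪ A₁) := hA₀.union hA₁
  obtain ⟨K, hK, hKA, hKU, -⟩ := hA.isOpen_compl.exists_iUnion_isClosed
  let E : Set C(X, ℝ) := {f | (∀ x, f x ∈ Set.Icc (0 : ℝ) 1) ∧ (∀ x ∈ A₀, f x = 0) ∧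
    ∀ x ∈ A₁, f x = 1}
  have hE : IsClosed E := by
    simp only [E, Set.ofPred_and, Set.ofPred_forall]
    have hcont : ∀ x : X, Continuous fun f : C(X, ℝ) ↦ f x := fun x ↦ by fun_prop
    exact (isClosed_iInter fun x ↦ isClosed_Icc.preimage (hcont x)).inter
      ((isClosed_iInter fun x ↦ isClosed_iInter fun _ ↦ isClosed_eq (hcont x) continuous_const).inter
      (isClosed_iInter fun x ↦ isClosed_iInter fun _ ↦ isClosed_eq (hcont x) continuous_const))
  have : CompleteSpace E := hE.completeSpace_coe
  have : Nonempty E := by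
    obtain ⟨f, h0, h1, hf⟩ := exists_continuous_zero_one_of_isClosed hA₀ hA₁ hdisj
    exact ⟨f, hf, h0, h1⟩
  let G : ℕ × ℕ → Set E := fun n ↦ {f | ∀ t ∈ Set.Icc (0 : ℝ) 1, ∀ μ ∈ N,
    (μ : Measure X) (f.1 ⁻¹' {t} ∩ K n.1) < ((n.2 : ENNReal))⁻¹}
  have hGo : ∀ n, IsOpen (G n) := fun n ↦
    (isOpen_setOf_forall_measure_fiber_inter_lt hN (hK n.1) _).preimage continuous_subtype_val
  have hGd : ∀ n, Dense (G n) := by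
    intro n
    rw [Metric.dense_iff]
    rintro ⟨f, hf, hf0, hf1⟩ r hr
    obtain ⟨g, hg, hgf, hgr, hgμ⟩ := exists_perturbation_measure_fiber_inter_lt hN hatomless hSBP
      hA (hK n.1) (Set.disjoint_left.2 fun x hx hxK ↦ hKA n.1 hxK hx)
      (ENNReal.inv_pos.2 (ENNReal.natCast_ne_top n.2)) (half_pos hr) f hf
    refine ⟨⟨g, hg, fun x hx ↦ (hgf (Or.inl hx)).trans (hf0 x hx),
      fun x hx ↦ (hgf (Or.inr hx)).trans (hf1 x hx)⟩, ?_, fun t _ ↦ hgμ t⟩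
    rw [Metric.mem_ball, Subtype.dist_eq]
    exact ((ContinuousMap.dist_le (half_pos hr).le).2 hgr).trans_lt (half_lt_self hr)
  obtain ⟨⟨f, hf, hf0, hf1⟩, hfG⟩ := (dense_iInter_of_isOpen hGo hGd).nonempty
  refine ⟨f, f.continuous, hf, hf0, hf1, fun t ht μ hμ ↦ ?_⟩
  rw [Set.sdiff_eq, ← hKU, Set.inter_iUnion]
  refine measure_iUnion_null fun m ↦ ?_
  by_contra hne
  obtain ⟨n, hn⟩ := ENNReal.exists_inv_nat_lt hne
  exact lt_asymm hn (Set.mem_iInter.1 hfG (m, n) t ht μ hμ)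
end

section
/- Let G ↪ X be a continuous action of a countable group on a compact metrizable space with the small boundary property and no finite orbits. Then for every continuous action H ↪ Y of a countable group on a compact metrizable space, the product action G × H ↪ X × Y has the small boundary property. -/
open MeasureTheory Topology

/-- A measure is invariant for the action of `G`. -/
def IsInvariantMeasure (G : Type*) {X : Type*} [Group G] [MulAction G X]
    [MeasurableSpace X] (μ : Measure X) : Prop :=
  ∀ g : G, Measure.map (fun x : X => g • x) μ = μ

/-- The small boundary property for the action of `G` on `X`: there is a basis of open
sets whose boundaries are null for every `G`-invariant Borel probability measure. -/
def ActionSBP (G X : Type*) [Group G] [MulAction G X] [TopologicalSpace X]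
    [MeasurableSpace X] : Prop :=
  ∃ B : Set (Set X), TopologicalSpace.IsTopologicalBasis B ∧
    ∀ U ∈ B, ∀ μ : ProbabilityMeasure X, IsInvariantMeasure G (μ : Measure X) →
      (μ : Measure X) (frontier U) = 0

/-- The small boundary property for the product action of `G × H` on `X × Y`. -/
def ProdActionSBP (G H X Y : Type*) [Group G] [Group H] [MulAction G X] [MulAction H Y]
    [TopologicalSpace X] [TopologicalSpace Y] [MeasurableSpace X] [MeasurableSpace Y] : Prop :=
  ∃ B : Set (Set (X × Y)), TopologicalSpace.IsTopologicalBasis B ∧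
    ∀ U ∈ B, ∀ μ : ProbabilityMeasure (X × Y),
      (∀ (g : G) (h : H),
        Measure.map (fun p : X × Y => (g • p.1, h • p.2)) (μ : Measure (X × Y)) =
          (μ : Measure (X × Y))) →
      (μ : Measure (X × Y)) (frontier U) = 0

/-- A closed set that is null for every invariant probability measure has neighbourhoods that are
uniformly small with respect to all of them. -/
lemma exists_cthickening_le_of_null {G X : Type*} [Group G] [PseudoMetricSpace X] [T2Space X]
    [CompactSpace X] [MeasurableSpace X] [BorelSpace X] [MulAction G X] [ContinuousConstSMul G X]
    {D : Set X} (hD : IsClosed D)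
    (hnull : ∀ ν : ProbabilityMeasure X, IsInvariantMeasure G (ν : Measure X) →
      (ν : Measure X) D = 0) {ε : ENNReal} (hε : ε ≠ 0) :
    ∃ r > 0, ∀ ν : ProbabilityMeasure X, IsInvariantMeasure G (ν : Measure X) →
      (ν : Measure X) (Metric.cthickening r D) ≤ ε := by
  by_contra! hcon
  choose ν hinv hlarge using fun n : ℕ => hcon (1 / ((n : ℝ) + 1)) (by positivity)
  let U : Filter ℕ := Filter.hyperfilter ℕ
  obtain ⟨ν₀, hν₀⟩ : ∃ ν₀, Filter.Tendsto ν U (𝓝 ν₀) :=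
    ⟨_, ((Filter.hyperfilter ℕ).map ν).le_nhds_lim⟩
  have hU : U ≤ Filter.atTop := Nat.hyperfilter_le_atTop
  have hinv₀ : IsInvariantMeasure G (ν₀ : Measure X) := by
    intro g
    have hg : Continuous fun x : X => g • x := continuous_const_smul g
    have h₁ := ((ProbabilityMeasure.continuous_map hg).tendsto ν₀).comp hν₀
    have h₂ : (fun μ : ProbabilityMeasure X => μ.map hg.measurable.aemeasurable) ∘ ν = ν := by
      funext n
      exact Subtype.ext (hinv n g)
    rw [h₂] at h₁
    exact congrArg (fun μ : ProbabilityMeasure X => (μ : Measure X)) (tendsto_nhds_unique h₁ hν₀)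
  have hge : ∀ r > 0, ε ≤ (ν₀ : Measure X) (Metric.cthickening r D) := by
    intro r hr
    refine le_trans ?_ (ProbabilityMeasure.limsup_measure_closed_le_of_tendsto hν₀
      (Metric.isClosed_cthickening (δ := r) (E := D)))
    refine Filter.le_limsup_of_frequently_le' (Filter.Eventually.frequently ?_)
    have hsmall : ∀ᶠ n : ℕ in U, 1 / ((n : ℝ) + 1) < r :=
      hU (tendsto_one_div_add_atTop_nhds_zero_nat.eventually (gt_mem_nhds hr))
    filter_upwards [hsmall] with n hn
    exact (hlarge n).le.trans (measure_mono (Metric.cthickening_mono hn.le D))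
  have hlim : Filter.Tendsto (fun r => (ν₀ : Measure X) (Metric.cthickening r D)) (𝓝[>] 0)
      (𝓝 ((ν₀ : Measure X) D)) :=
    (tendsto_measure_cthickening_of_isClosed
      ⟨1, one_pos, measure_ne_top _ _⟩ hD).mono_left nhdsWithin_le_nhds
  have := ge_of_tendsto hlim (by filter_upwards [self_mem_nhdsWithin] with r hr using hge r hr)
  rw [hnull ν₀ hinv₀] at this
  exact hε (le_zero_iff.mp this)

/-- An invariant finite measure has no atoms at points with infinite orbit. -/
lemma IsInvariantMeasure.measure_singleton_eq_zero {G X : Type*} [Group G] [MulAction G X]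
    [MeasurableSpace X] [MeasurableSingletonClass X] {μ : Measure X} [IsFiniteMeasure μ]
    (hμ : IsInvariantMeasure G μ) (hmeas : ∀ g : G, Measurable fun x : X => g • x)
    {x : X} (hx : (MulAction.orbit G x).Infinite) : μ {x} = 0 := by
  by_contra hne
  refine measure_ne_top μ _ (hx.meas_eq_top ⟨μ {x}, hne, ?_⟩)
  rintro _ ⟨g, rfl⟩
  refine le_of_eq ?_
  conv_rhs => rw [← hμ g, Measure.map_apply (hmeas g) (measurableSet_singleton _)]
  congr 1
  ext y
  simp

/-- A real-valued function on a finite type can be perturbed to an injective one. -/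
lemma exists_injective_abs_sub_lt {ι : Type*} [Finite ι] (a : ι → ℝ) {δ : ℝ} (hδ : 0 < δ) :
    ∃ c : ι → ℝ, Function.Injective c ∧ ∀ i, |c i - a i| < δ := by
  classical
  have key : ∀ s : Finset ι, ∃ c : ι → ℝ, Set.InjOn c s ∧ ∀ i, |c i - a i| < δ := by
    intro s
    induction s using Finset.induction_on with
    | empty => exact ⟨a, by simp, fun i => by simpa using hδ⟩
    | insert j s hj ih =>
      obtain ⟨c, hc, hca⟩ := ih
      obtain ⟨t, ht, hts⟩ := (Set.Ioo_infinite (show a j < a j + δ by linarith)).exists_notMem_finset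
        (s.image c)
      have hts' : ∀ i ∈ s, c i ≠ t := fun i hi h => hts (Finset.mem_image.mpr ⟨i, hi, h⟩)
      refine ⟨Function.update c j t, ?_, fun i => ?_⟩
      · intro i hi k hk hik
        simp only [Function.update_apply] at hik
        simp only [Finset.coe_insert, Set.mem_insert_iff, Finset.mem_coe] at hi hk
        have := @hc i
        grind
      · by_cases hi : i = j
        · subst hi
          rw [Function.update_self, abs_lt]
          constructor <;> linarith [ht.1, ht.2]
        · rw [Function.update_of_ne hi]
          exact hca i
  have := Fintype.ofFinite ι
  obtain ⟨c, hc, hca⟩ := key Finset.univ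
  exact ⟨c, by simpa using hc, hca⟩

/-- The level bands of width `r` of `h` have mass at most `ε` for every invariant probability
measure. -/
def HasSmallBands (G : Type*) {X : Type*} [Group G] [MulAction G X] [MeasurableSpace X]
    (h : X → ℝ) (ε : ENNReal) (r : ℝ) : Prop :=
  ∀ ν : ProbabilityMeasure X, IsInvariantMeasure G (ν : Measure X) → ∀ c : ℝ,
    (ν : Measure X) {x | |h x - c| ≤ r} ≤ ε

/-- Under the small boundary property and absence of finite orbits, every continuous function can
be perturbed so as to have uniformly small level bands. -/
lemma ActionSBP.exists_hasSmallBands {G X : Type*} [Group G] [MetricSpace X]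
    [CompactSpace X] [MeasurableSpace X] [BorelSpace X] [MulAction G X] [ContinuousConstSMul G X]
    (hSBP : ActionSBP G X) (horbits : ∀ x : X, (MulAction.orbit G x).Infinite)
    (f : C(X, ℝ)) {δ : ℝ} (hδ : 0 < δ) {ε : ENNReal} (hε : ε ≠ 0) :
    ∃ h : C(X, ℝ), dist h f ≤ δ ∧ ∃ r > 0, HasSmallBands G h ε r := by
  classical
  obtain ⟨B, hB, hBnull⟩ := hSBP
  have hε2 : ε / 2 ≠ 0 := by simp [hε]
  have hloc : ∀ x : X, ∃ U ∈ B, x ∈ U ∧ (∀ y ∈ U, |f y - f x| < δ / 4) ∧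
      ∀ ν : ProbabilityMeasure X, IsInvariantMeasure G (ν : Measure X) →
        (ν : Measure X) U ≤ ε / 2 := by
    intro x
    obtain ⟨r, hr, hrν⟩ := exists_cthickening_le_of_null (G := G) (isClosed_singleton (x := x))
      (fun ν hν => hν.measure_singleton_eq_zero
        (fun g => (continuous_const_smul g).measurable) (horbits x)) hε2
    have hN : Metric.ball x r ∩ {y | |f y - f x| < δ / 4} ∈ 𝓝 x := by
      refine Filter.inter_mem (Metric.ball_mem_nhds x hr) ?_
      refine IsOpen.mem_nhds (isOpen_lt (by fun_prop) continuous_const) ?_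
      simpa using hδ
    obtain ⟨U, hU, hxU, hUN⟩ := hB.mem_nhds_iff.mp hN
    refine ⟨U, hU, hxU, fun y hy => (hUN hy).2, fun ν hν =>
      (measure_mono fun y hy => ?_).trans (hrν ν hν)⟩
    rw [Metric.cthickening_singleton _ hr.le]
    exact Metric.ball_subset_closedBall (hUN hy).1
  choose U hUB hxU hUf hUν using hloc
  obtain ⟨t, ht⟩ := isCompact_univ.elim_finite_subcover U (fun x => hB.isOpen (hUB x))
    (fun x _ => Set.mem_iUnion.mpr ⟨x, hxU x⟩)
  have hcov : ∀ x : X, ∃ i ∈ t, x ∈ U i := fun x => by simpa using ht (Set.mem_univ x)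
  let D : Set X := ⋃ i ∈ t, frontier (U i)
  have hDclosed : IsClosed D := t.finite_toSet.isClosed_biUnion fun i _ => isClosed_frontier
  obtain ⟨ρ, hρ, hρν⟩ := exists_cthickening_le_of_null (G := G) hDclosed
    (fun ν hν => (measure_biUnion_null_iff t.countable_toSet).mpr
      fun i _ => hBnull _ (hUB i) ν hν) hε2
  let K : Set X := (Metric.thickening ρ D)ᶜ
  have hK : IsClosed K := Metric.isOpen_thickening.isClosed_compl
  have hKD : ∀ x ∈ K, ∀ i ∈ t, x ∉ frontier (U i) := fun x hx i hi hxi =>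
    hx (Metric.self_subset_thickening hρ D (Set.mem_biUnion (x := i) hi hxi))
  let P : X → {s : Finset X // s ∈ t.powerset} := fun x =>
    ⟨t.filter fun i => x ∈ U i, Finset.mem_powerset.mpr (Finset.filter_subset _ _)⟩
  have hmemP : ∀ x i, i ∈ (P x).1 ↔ i ∈ t ∧ x ∈ U i := fun x i => Finset.mem_filter
  have hPne : ∀ x, (P x).1.Nonempty := fun x =>
    let ⟨i, hi⟩ := hcov x
    ⟨i, (hmemP x i).mpr hi⟩
  let a : {s : Finset X // s ∈ t.powerset} → ℝ := fun s =>
    if hs : s.1.Nonempty then f hs.choose else 0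
  have ha : ∀ x, |f x - a (P x)| < δ / 4 := by
    intro x
    simp only [a, dif_pos (hPne x)]
    exact hUf _ x ((hmemP x _).mp (hPne x).choose_spec).2
  obtain ⟨c, hc, hca⟩ := exists_injective_abs_sub_lt a (show 0 < δ / 4 by linarith)
  have hPloc : ∀ x ∈ K, ∀ᶠ y in 𝓝 x, P y = P x := by
    intro x hx
    have : ∀ᶠ y in 𝓝 x, ∀ i ∈ t, (y ∈ U i ↔ x ∈ U i) := by
      rw [Filter.eventually_all_finset]
      intro i hi
      by_cases hxi : x ∈ U i
      · filter_upwards [(hB.isOpen (hUB i)).mem_nhds hxi] with y hy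
        simp [hy, hxi]
      · have : x ∉ closure (U i) := fun h => hKD x hx i hi
          ⟨h, by rwa [(hB.isOpen (hUB i)).interior_eq]⟩
        filter_upwards [isClosed_closure.isOpen_compl.mem_nhds this] with y hy
        have : y ∉ U i := fun h => hy (subset_closure h)
        simp [this, hxi]
    filter_upwards [this] with y hy
    apply Subtype.ext
    ext i
    rw [hmemP, hmemP]
    exact and_congr_right (hy i)
  let g₀ : C(K, ℝ) := ⟨fun x => c (P x) - f x, by
    refine Continuous.sub ?_ (by fun_prop)
    rw [continuous_iff_continuousAt]
    intro x
    have h₁ : ∀ᶠ y : K in 𝓝 x, P (y : X) = P x :=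
      continuous_subtype_val.continuousAt.eventually (hPloc x x.2)
    refine (continuousAt_const (y := c (P x))).congr ?_
    filter_upwards [h₁] with y hy
    rw [hy]⟩
  obtain ⟨g, hg, hgK⟩ := g₀.exists_restrict_eq_forall_mem_of_closed (t := Set.Icc (-δ) δ)
    (fun x => by
      have h₁ := abs_lt.mp (ha x)
      have h₂ := abs_lt.mp (hca (P x))
      constructor <;> simp only [g₀, ContinuousMap.coe_mk] <;> linarith)
    (Set.nonempty_Icc.mpr (by linarith)) hK
  have hgK' : ∀ x ∈ K, (f + g) x = c (P x) := by
    intro x hx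
    have := DFunLike.congr_fun hgK ⟨x, hx⟩
    simp only [g₀, ContinuousMap.coe_mk] at this
    have h₂ : g x = c (P x) - f x := this
    simp [h₂]
  refine ⟨f + g, ?_, ?_⟩
  · rw [ContinuousMap.dist_le hδ.le]
    intro x
    rw [Real.dist_eq, ContinuousMap.add_apply, add_sub_cancel_left]
    exact abs_le.mpr (hg x)
  obtain ⟨r, hr, hrc⟩ : ∃ r > 0, ∀ p q, p ≠ q → 2 * r < |c p - c q| := by
    have : ∀ᶠ r : ℝ in 𝓝[>] 0, ∀ p q, p ≠ q → 2 * r < |c p - c q| := by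
      simp only [Filter.eventually_all]
      intro p q hpq
      have hpos : 0 < |c p - c q| := abs_pos.mpr (sub_ne_zero.mpr (hc.ne hpq))
      have h₀ : Filter.Tendsto (fun r : ℝ => 2 * r) (𝓝[>] 0) (𝓝 (2 * 0)) :=
        ((continuous_const.mul continuous_id).tendsto 0).mono_left nhdsWithin_le_nhds
      exact h₀.eventually (gt_mem_nhds (by simpa using hpos))
    obtain ⟨r, h₁, h₂⟩ := (this.and self_mem_nhdsWithin).exists
    exact ⟨r, h₂, h₁⟩
  refine ⟨r, hr, fun ν hν z => ?_⟩
  have hband : ∃ i : Set X, (ν : Measure X) i ≤ ε / 2 ∧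
      {x | |(f + g) x - z| ≤ r} ⊆ i ∪ Metric.cthickening ρ D := by
    by_cases hex : ∃ x ∈ K, |(f + g) x - z| ≤ r
    · obtain ⟨x, hxK, hx⟩ := hex
      obtain ⟨i, hi⟩ := hPne x
      refine ⟨U i, hUν i ν hν, fun y hy => ?_⟩
      by_cases hyK : y ∈ K
      · left
        have hP : P y = P x := by
          by_contra hne
          have h₁ := hrc _ _ hne
          rw [← hgK' x hxK, ← hgK' y hyK] at h₁
          have hy' : |(f + g) y - z| ≤ r := hy
          have h₂ := abs_sub_le ((f + g) y) z ((f + g) x)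
          rw [abs_sub_comm z] at h₂
          linarith
        rw [← hP] at hi
        exact ((hmemP y i).mp hi).2
      · right
        exact Metric.thickening_subset_cthickening ρ D (not_not.mp hyK)
    · refine ⟨∅, by simp, fun y hy => Or.inr ?_⟩
      have hyK : y ∉ K := fun h => hex ⟨y, h, hy⟩
      exact Metric.thickening_subset_cthickening ρ D (not_not.mp hyK)
  obtain ⟨i, hi, hsub⟩ := hband
  calc (ν : Measure X) {x | |(f + g) x - z| ≤ r}
      ≤ (ν : Measure X) i + (ν : Measure X) (Metric.cthickening ρ D) :=
        (measure_mono hsub).trans (measure_union_le _ _)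
    _ ≤ ε / 2 + ε / 2 := add_le_add hi (hρν ν hν)
    _ = ε := ENNReal.add_halves ε

/-- There is a continuous function whose level bands are uniformly small for all invariant
probability measures, as their width tends to zero. -/
lemma ActionSBP.exists_forall_hasSmallBands {G X : Type*} [Group G] [MetricSpace X]
    [CompactSpace X] [MeasurableSpace X] [BorelSpace X] [MulAction G X] [ContinuousConstSMul G X]
    (hSBP : ActionSBP G X) (horbits : ∀ x : X, (MulAction.orbit G x).Infinite) :
    ∃ h : C(X, ℝ), ∀ ε : ENNReal, ε ≠ 0 → ∃ r > 0, HasSmallBands G h ε r := by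
  let O : ℕ → Set C(X, ℝ) := fun n => {h | ∃ r > 0, HasSmallBands G h (n : ENNReal)⁻¹ r}
  have hopen : ∀ n, IsOpen (O n) := by
    intro n
    rw [Metric.isOpen_iff]
    rintro h ⟨r, hr, hband⟩
    refine ⟨r / 2, by linarith, fun h' hh' => ⟨r / 2, by linarith, fun ν hν c => ?_⟩⟩
    refine (measure_mono fun x (hx : |h' x - c| ≤ r / 2) => ?_).trans (hband ν hν c)
    have h₁ : |h' x - h x| < r / 2 :=
      (ContinuousMap.dist_apply_le_dist x).trans_lt (Metric.mem_ball.mp hh')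
    have h₂ := abs_sub_le (h x) (h' x) c
    rw [abs_sub_comm (h x) (h' x)] at h₂
    change |h x - c| ≤ r
    linarith
  have hdense : ∀ n, Dense (O n) := by
    intro n
    rw [Metric.dense_iff]
    intro f δ hδ
    obtain ⟨h, hf, hh⟩ := hSBP.exists_hasSmallBands horbits f (half_pos hδ)
      (ENNReal.inv_ne_zero.mpr (ENNReal.natCast_ne_top n))
    exact ⟨h, Metric.mem_ball.mpr (by linarith), hh⟩
  obtain ⟨h, hh⟩ := (dense_iInter_of_isOpen_nat hopen hdense).nonempty
  refine ⟨h, fun ε hε => ?_⟩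
  obtain ⟨n, hn⟩ := ENNReal.exists_inv_nat_lt hε
  obtain ⟨r, hr, hband⟩ := Set.mem_iInter.mp hh n
  exact ⟨r, hr, fun ν hν c => (hband ν hν c).trans hn.le⟩

/-- If the level bands of `h` are uniformly small, then the coincidence set of `h x` and `φ y` is
null for every measure on the product that is invariant under the action on the first factor. -/
lemma measure_eq_zero_of_hasSmallBands {G X Y : Type*} [Group G] [MulAction G X]
    [MeasurableSpace X] [MeasurableSpace Y] (hmeas : ∀ g : G, Measurable fun x : X => g • x)
    {h : X → ℝ} (hh : Measurable h)
    (hband : ∀ ε : ENNReal, ε ≠ 0 → ∃ r > 0, HasSmallBands G h ε r)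
    {φ : Y → ℝ} (hφ : Measurable φ) {μ : Measure (X × Y)} [IsFiniteMeasure μ]
    (hμ : ∀ g : G, μ.map (fun p => (g • p.1, p.2)) = μ) :
    μ {p | h p.1 = φ p.2} = 0 := by
  have hpair : ∀ g : G, Measurable fun p : X × Y => (g • p.1, p.2) :=
    fun g => ((hmeas g).comp measurable_fst).prodMk measurable_snd
  have hslice : ∀ ε : ENNReal, ∀ r, HasSmallBands G h ε r → ∀ A : Set Y, MeasurableSet A →
      ∀ c, μ ({x | |h x - c| ≤ r} ×ˢ A) ≤ ε * μ (Prod.snd ⁻¹' A) := by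
    intro ε r hr A hA c
    have hbm : MeasurableSet {x | |h x - c| ≤ r} :=
      measurableSet_le (by fun_prop) measurable_const
    by_cases h0 : μ (Prod.snd ⁻¹' A) = 0
    · rw [h0, mul_zero]
      exact (measure_mono_null (fun p hp => hp.2) h0).le
    let ν : Measure X := (μ (Prod.snd ⁻¹' A))⁻¹ • (μ.restrict (Prod.snd ⁻¹' A)).map Prod.fst
    have hνapp : ∀ S, MeasurableSet S → ν S = (μ (Prod.snd ⁻¹' A))⁻¹ * μ (S ×ˢ A) := by
      intro S hS
      simp only [ν, Measure.smul_apply, smul_eq_mul]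
      rw [Measure.map_apply measurable_fst hS, Measure.restrict_apply (measurable_fst hS)]
      rfl
    have hνprob : IsProbabilityMeasure ν := ⟨by
      rw [hνapp _ MeasurableSet.univ, Set.univ_prod]
      exact ENNReal.inv_mul_cancel h0 (measure_ne_top _ _)⟩
    have hνinv : IsInvariantMeasure G ν := by
      intro g
      ext S hS
      rw [Measure.map_apply (hmeas g) hS, hνapp _ (hmeas g hS), hνapp _ hS]
      congr 1
      conv_rhs => rw [← hμ g]
      rw [Measure.map_apply (hpair g) (hS.prod hA)]
      rfl
    have := hr ⟨ν, hνprob⟩ hνinv c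
    rw [ProbabilityMeasure.coe_mk, hνapp _ hbm, mul_comm, ← div_eq_mul_inv,
      ENNReal.div_le_iff h0 (measure_ne_top _ _)] at this
    exact this
  have hle : ∀ ε : ENNReal, ε ≠ 0 → μ {p | h p.1 = φ p.2} ≤ ε * μ Set.univ := by
    intro ε hε
    obtain ⟨r, hr, hrband⟩ := hband ε hε
    let κ : Y → ℤ := fun y => ⌊φ y / r⌋
    have hκ : Measurable κ := (hφ.div_const r).floor
    have hfib : ∀ k : ℤ, MeasurableSet (κ ⁻¹' {k}) := fun k => hκ (measurableSet_singleton k)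
    have hcover : {p : X × Y | h p.1 = φ p.2} ⊆
        ⋃ k : ℤ, {x | |h x - k * r| ≤ r} ×ˢ (κ ⁻¹' {k}) := by
      intro p hp
      refine Set.mem_iUnion.mpr ⟨κ p.2, ?_, rfl⟩
      have hp' : h p.1 = φ p.2 := hp
      have h₁ : (κ p.2 : ℝ) * r ≤ φ p.2 := (le_div_iff₀ hr).mp (Int.floor_le (φ p.2 / r))
      have h₂ : φ p.2 < (κ p.2 + 1 : ℝ) * r :=
        (div_lt_iff₀ hr).mp (Int.lt_floor_add_one (φ p.2 / r))
      change |h p.1 - κ p.2 * r| ≤ r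
      rw [hp', abs_le]
      constructor <;> linarith
    calc μ {p | h p.1 = φ p.2}
        ≤ ∑' k : ℤ, μ ({x | |h x - k * r| ≤ r} ×ˢ (κ ⁻¹' {k})) :=
          (measure_mono hcover).trans (measure_iUnion_le _)
      _ ≤ ∑' k : ℤ, ε * μ ((κ ∘ Prod.snd) ⁻¹' {k}) :=
          ENNReal.tsum_le_tsum fun k => hslice ε r hrband _ (hfib k) _
      _ = ε * μ Set.univ := by
          rw [ENNReal.tsum_mul_left]
          congr 1
          rw [← measure_iUnion]
          · congr 1
            ext p
            simp
          · intro i j hij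
            exact (Set.disjoint_singleton.mpr hij).preimage _
          · exact fun k => measurable_snd (hfib k)
  by_contra hne
  obtain ⟨n, hn⟩ := ENNReal.exists_nat_mul_gt hne (measure_ne_top μ Set.univ)
  have hn0 : (n : ENNReal) ≠ 0 := by
    intro h
    simp [h] at hn
  have := hle (n : ENNReal)⁻¹ (ENNReal.inv_ne_zero.mpr (ENNReal.natCast_ne_top n))
  rw [mul_comm, ← div_eq_mul_inv,
    ENNReal.le_div_iff_mul_le (Or.inl hn0) (Or.inl (ENNReal.natCast_ne_top n)), mul_comm] at this
  exact absurd hn (not_lt.mpr this)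

theorem sbp_no_finite_orbits_implies_product_sbp {G X : Type*} [Group G] [Countable G]
    [TopologicalSpace X] [CompactSpace X] [TopologicalSpace.MetrizableSpace X]
    [MeasurableSpace X] [BorelSpace X] [MulAction G X] [ContinuousConstSMul G X]
    (hSBP : ActionSBP G X) (horbits : ∀ x : X, (MulAction.orbit G x).Infinite) :
    ∀ (H Y : Type*) [Group H] [Countable H]
      [TopologicalSpace Y] [CompactSpace Y] [TopologicalSpace.MetrizableSpace Y]
      [MeasurableSpace Y] [BorelSpace Y] [MulAction H Y] [ContinuousConstSMul H Y],
      ProdActionSBP G H X Y := by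
  intro H Y _ _ _ _ _ _ _ _ _
  let _ : MetricSpace X := TopologicalSpace.metrizableSpaceMetric X
  let _ : MetricSpace Y := TopologicalSpace.metrizableSpaceMetric Y
  obtain ⟨h, hh⟩ := hSBP.exists_forall_hasSmallBands horbits
  obtain ⟨B, hB, hBnull⟩ := hSBP
  refine ⟨{O | IsOpen O ∧ ∀ μ : ProbabilityMeasure (X × Y),
      (∀ (g : G) (k : H),
        Measure.map (fun p : X × Y => (g • p.1, k • p.2)) (μ : Measure (X × Y)) =
          (μ : Measure (X × Y))) →
      (μ : Measure (X × Y)) (frontier O) = 0}, ?_, fun O hO => hO.2⟩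
  refine TopologicalSpace.isTopologicalBasis_of_isOpen_of_nhds (fun O hO => hO.1) ?_
  rintro ⟨x₀, y₀⟩ W hxW hW
  obtain ⟨A, hA, C, hC, hAC⟩ := mem_nhds_prod_iff.mp (hW.mem_nhds hxW)
  obtain ⟨U, hU, hxU, hUA⟩ := hB.mem_nhds_iff.mp hA
  obtain ⟨s, hs, hsC⟩ := Metric.mem_nhds_iff.mp hC
  obtain ⟨α, hα, hαh⟩ : ∃ α > 0, ∀ x, |α * h x| < s / 2 := by
    refine ⟨s / (2 * (‖h‖ + 1)), by positivity, fun x => ?_⟩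
    have h₁ : |h x| ≤ ‖h‖ := h.norm_coe_le_norm x
    have h₂ : 0 < s / (2 * (‖h‖ + 1)) := by positivity
    rw [abs_mul, abs_of_pos h₂]
    calc s / (2 * (‖h‖ + 1)) * |h x| < s / (2 * (‖h‖ + 1)) * (‖h‖ + 1) := by
          gcongr
          linarith
      _ = s / 2 := by field_simp
  have hcont : Continuous fun p : X × Y => α * h p.1 + dist p.2 y₀ := by fun_prop
  have hUo : IsOpen U := hB.isOpen hU
  refine ⟨Prod.fst ⁻¹' U ∩ {p | α * h p.1 + dist p.2 y₀ < s / 2},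
    ⟨(hUo.preimage continuous_fst).inter (isOpen_lt hcont continuous_const), fun μ hμ => ?_⟩,
    ⟨hxU, ?_⟩, fun p hp => hAC ⟨hUA hp.1, hsC ?_⟩⟩
  · have hinv : ∀ g : G, (μ : Measure (X × Y)).map (fun p => (g • p.1, p.2)) = μ := fun g => by
      simpa using hμ g 1
    have hmeas : ∀ g : G, Measurable fun x : X => g • x :=
      fun g => (continuous_const_smul g).measurable
    have hpair : ∀ g : G, Measurable fun p : X × Y => (g • p.1, p.2) :=
      fun g => ((hmeas g).comp measurable_fst).prodMk measurable_snd
    have hfst : (μ : Measure (X × Y)) (Prod.fst ⁻¹' frontier U) = 0 := by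
      have := hBnull U hU (μ.map measurable_fst.aemeasurable) (fun g => by
        rw [ProbabilityMeasure.toMeasure_map, Measure.map_map (hmeas g) measurable_fst]
        conv_rhs => rw [← hinv g]
        rw [Measure.map_map measurable_fst (hpair g)]
        rfl)
      rwa [ProbabilityMeasure.toMeasure_map,
        Measure.map_apply measurable_fst isClosed_frontier.measurableSet] at this
    have hlevel := measure_eq_zero_of_hasSmallBands hmeas h.continuous.measurable hh
      (φ := fun y => (s / 2 - dist y y₀) / α) (Continuous.measurable (by fun_prop)) hinv
    refine measure_mono_null ?_ (measure_union_null hfst hlevel)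
    refine (frontier_inter_subset _ _).trans ?_
    rintro p (⟨hp, -⟩ | ⟨-, hp⟩)
    · exact Or.inl (continuous_fst.frontier_preimage_subset U hp)
    · right
      have := frontier_lt_subset_eq hcont continuous_const hp
      simp only [Set.mem_ofPred_eq] at this ⊢
      rw [eq_div_iff hα.ne']
      linarith
  · have := (abs_lt.mp (hαh x₀)).2
    simpa using this
  · have h₁ := (abs_lt.mp (hαh p.1)).1
    have h₂ : α * h p.1 + dist p.2 y₀ < s / 2 := hp.2
    rw [Metric.mem_ball]
    linarith
end
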